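/- Let G be a strongly connected digraph and let e be a strong bridge of G. Then every digraph in S(G,e) is strongly connected. -/

import Mathlib

/-- A directed multigraph: a type `E` of potential edges with source and target
maps, together with the set of edges actually present in the digraph. -/
structure MultiDigraph (V : Type) (E : Type) where
  edges : Set E
  src : E → V
  tgt : E → V

namespace MultiDigraph

variable {V E : Type}

/-- `G.IsWalk u v l` : the list of edges `l` forms a walk from `u` to `v`
(consecutive edges compose). -/
def IsWalk (G : MultiDigraph V E) : V → V → List E → Prop
  | u, v, [] => u = v
  | u, v, e :: l => e ∈ G.edges ∧ G.src e = u ∧ G.IsWalk (G.tgt e) v l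

/-- A path from `u` to `v`: a walk using no edge more than once. -/
def IsTrail (G : MultiDigraph V E) (u v : V) (l : List E) : Prop :=
  G.IsWalk u v l ∧ l.Nodup

/-- `u` reaches `v`: there is a path from `u` to `v`. -/
def Reaches (G : MultiDigraph V E) (u v : V) : Prop :=
  ∃ l : List E, G.IsTrail u v l

/-- `u` and `v` are strongly connected: each reaches the other. -/
def SConn (G : MultiDigraph V E) (u v : V) : Prop :=
  G.Reaches u v ∧ G.Reaches v u

/-- The digraph is strongly connected. -/
def StronglyConnected (G : MultiDigraph V E) : Prop :=
  ∀ u v : V, G.Reaches u v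

/-- Delete the edge `e`. -/
def deleteEdge (G : MultiDigraph V E) (e : E) : MultiDigraph V E :=
  { G with edges := G.edges \ {e} }

/-- A strong bridge: an edge whose deletion destroys strong connectivity. -/
def IsStrongBridge (G : MultiDigraph V E) (e : E) : Prop :=
  e ∈ G.edges ∧ ¬ (G.deleteEdge e).StronglyConnected

end MultiDigraph

namespace MultiDigraph

variable {V E : Type}

/-- `C` is a strongly connected component of `G` (as a set of vertices):
the equivalence class of some vertex under mutual reachability. -/
def IsSCC (G : MultiDigraph V E) (C : Set V) : Prop :=
  ∃ c : V, C = {w | G.SConn c w}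

/-- The digraph `C'` of `S(G,(x,y))` corresponding to the strongly connected
component `C` of `G \ (x,y)`, where `(x,y)` is the strong bridge `e₀`:
it keeps every edge of `G` with both endpoints in `C`, adds one edge `(u,x)`
for every edge `(u,v)` of `G` with `u ∈ C`, `v ∉ C`, one edge `(y,v)` for every
edge `(u,v)` of `G` with `u ∉ C`, `v ∈ C`, and the extra edge `(x,y)`
(represented by `Sum.inr ()`). -/
noncomputable def sOp (G : MultiDigraph V E) (e₀ : E) (C : Set V) :
    MultiDigraph V (E ⊕ Unit) := by
  classical
  exact
    { edges := Sum.inl '' {e | e ∈ G.edges ∧ (G.src e ∈ C ∨ G.tgt e ∈ C)} ∪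
        {Sum.inr ()}
      src := fun p =>
        match p with
        | Sum.inl e => if G.src e ∈ C then G.src e else G.tgt e₀
        | Sum.inr _ => G.src e₀
      tgt := fun p =>
        match p with
        | Sum.inl e => if G.tgt e ∈ C then G.tgt e else G.src e₀
        | Sum.inr _ => G.tgt e₀ }

/-- The digraph `G` is strongly connected when regarded as a digraph with
vertex set `W` : every vertex of `W` reaches every other vertex of `W`. -/
def SCOn (G : MultiDigraph V E) (W : Set V) : Prop :=
  ∀ a ∈ W, ∀ b ∈ W, G.Reaches a b

end MultiDigraph

namespace MultiDigraph

variable {V E : Type}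

theorem IsWalk.exists_of_append {G : MultiDigraph V E} {v : V} {l₂ : List E} :
    ∀ {l₁ : List E} {u : V}, G.IsWalk u v (l₁ ++ l₂) → ∃ w, G.IsWalk w v l₂
  | [], u, h => ⟨u, h⟩
  | _ :: _, _, h => h.2.2.exists_of_append

theorem Reaches.refl (G : MultiDigraph V E) (u : V) : G.Reaches u u :=
  ⟨[], rfl, List.nodup_nil⟩

theorem Reaches.head {G : MultiDigraph V E} {e : E} {v : V} (he : e ∈ G.edges)
    (h : G.Reaches (G.tgt e) v) : G.Reaches (G.src e) v := by
  obtain ⟨l, hw, hn⟩ := h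
  by_cases hel : e ∈ l
  · obtain ⟨l₁, l₂, rfl⟩ := List.append_of_mem hel
    obtain ⟨w, hw'⟩ := hw.exists_of_append
    exact ⟨e :: l₂, ⟨he, rfl, hw'.2.2⟩, hn.of_append_right⟩
  · exact ⟨e :: l, ⟨he, rfl, hw⟩, List.nodup_cons.2 ⟨hel, hn⟩⟩

/-- Some edge of `G` goes from `u` to `v`. -/
def HasEdge (G : MultiDigraph V E) (u v : V) : Prop :=
  ∃ e ∈ G.edges, G.src e = u ∧ G.tgt e = v

theorem IsWalk.reflTransGen {G : MultiDigraph V E} {v : V} :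
    ∀ {l : List E} {u : V}, G.IsWalk u v l → Relation.ReflTransGen G.HasEdge u v
  | [], _, h => h ▸ .refl
  | e :: _, _, ⟨he, hs, h⟩ => .head ⟨e, he, hs, rfl⟩ h.reflTransGen

theorem reaches_iff_reflTransGen {G : MultiDigraph V E} {u v : V} :
    G.Reaches u v ↔ Relation.ReflTransGen G.HasEdge u v := by
  refine ⟨fun ⟨_, hw, _⟩ => hw.reflTransGen, fun h => ?_⟩
  induction h using Relation.ReflTransGen.head_induction_on with
  | refl => exact .refl G v
  | head h _ ih =>
    obtain ⟨e, he, rfl, rfl⟩ := h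
    exact ih.head he

section sOp

variable {G : MultiDigraph V E} {e₀ : E} {C : Set V} {u v : V}

theorem sOp_hasEdge_bridge : (G.sOp e₀ C).HasEdge (G.src e₀) (G.tgt e₀) :=
  ⟨Sum.inr (), by simp [sOp], rfl, rfl⟩

theorem HasEdge.sOp_of_mem_of_mem (h : G.HasEdge u v) (hu : u ∈ C) (hv : v ∈ C) :
    (G.sOp e₀ C).HasEdge u v := by
  obtain ⟨e, he, rfl, rfl⟩ := h
  exact ⟨Sum.inl e, by simp [sOp, he, hu], by simp [sOp, hu], by simp [sOp, hv]⟩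

theorem HasEdge.sOp_of_mem_of_notMem (h : G.HasEdge u v) (hu : u ∈ C) (hv : v ∉ C) :
    (G.sOp e₀ C).HasEdge u (G.src e₀) := by
  obtain ⟨e, he, rfl, rfl⟩ := h
  exact ⟨Sum.inl e, by simp [sOp, he, hu], by simp [sOp, hu], by simp [sOp, hv]⟩

theorem HasEdge.sOp_of_notMem_of_mem (h : G.HasEdge u v) (hu : u ∉ C) (hv : v ∈ C) :
    (G.sOp e₀ C).HasEdge (G.tgt e₀) v := by
  obtain ⟨e, he, rfl, rfl⟩ := h
  exact ⟨Sum.inl e, by simp [sOp, he, hv], by simp [sOp, hu], by simp [sOp, hv]⟩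

theorem reflTransGen_sOp_src (h : Relation.ReflTransGen G.HasEdge u (G.src e₀))
    (hu : u ∈ C) : Relation.ReflTransGen (G.sOp e₀ C).HasEdge u (G.src e₀) := by
  induction h using Relation.ReflTransGen.head_induction_on with
  | refl => exact .refl
  | @head a c h _ ih =>
    by_cases hc : c ∈ C
    · exact .head (h.sOp_of_mem_of_mem hu hc) (ih hc)
    · exact .single (h.sOp_of_mem_of_notMem hu hc)

theorem reflTransGen_sOp_tgt (h : Relation.ReflTransGen G.HasEdge (G.tgt e₀) v)
    (hv : v ∈ C) : Relation.ReflTransGen (G.sOp e₀ C).HasEdge (G.tgt e₀) v := by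
  induction h with
  | refl => exact .refl
  | @tail b c _ h ih =>
    by_cases hb : b ∈ C
    · exact .tail (ih hb) (h.sOp_of_mem_of_mem hb hv)
    · exact .single (h.sOp_of_notMem_of_mem hb hv)

end sOp

theorem IsSCC.nonempty {G : MultiDigraph V E} {C : Set V} (hC : G.IsSCC C) : C.Nonempty := by
  obtain ⟨c, rfl⟩ := hC
  exact ⟨c, .refl G c, .refl G c⟩

end MultiDigraph

/-- Let `e₀ = (x,y)` be a strong bridge of the strongly
connected digraph `G`. Then every digraph of `S(G,e₀)` is strongly connected
(as a digraph on its vertex set `C ∪ {x,y}`). -/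
theorem statement_12 {V E : Type} (G : MultiDigraph V E)
    (hG : G.StronglyConnected) (e₀ : E) (hbr : G.IsStrongBridge e₀) :
    ∀ C : Set V, (G.deleteEdge e₀).IsSCC C →
      (G.sOp e₀ C).SCOn (insert (G.src e₀) (insert (G.tgt e₀) C)) := by
  intro C hC
  obtain ⟨c, hc⟩ := hC.nonempty
  have toSrc : ∀ u ∈ C, Relation.ReflTransGen (G.sOp e₀ C).HasEdge u (G.src e₀) := fun u hu =>
    MultiDigraph.reflTransGen_sOp_src (MultiDigraph.reaches_iff_reflTransGen.1 (hG _ _)) hu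
  have fromTgt : ∀ v ∈ C, Relation.ReflTransGen (G.sOp e₀ C).HasEdge (G.tgt e₀) v := fun v hv =>
    MultiDigraph.reflTransGen_sOp_tgt (MultiDigraph.reaches_iff_reflTransGen.1 (hG _ _)) hv
  have bridge := MultiDigraph.sOp_hasEdge_bridge (G := G) (e₀ := e₀) (C := C)
  have tgtSrc := (fromTgt c hc).trans (toSrc c hc)
  intro a ha b hb
  rw [MultiDigraph.reaches_iff_reflTransGen]
  have haSrc : Relation.ReflTransGen (G.sOp e₀ C).HasEdge a (G.src e₀) := by
    rcases ha with rfl | rfl | ha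
    exacts [.refl, tgtSrc, toSrc a ha]
  have hTgtb : Relation.ReflTransGen (G.sOp e₀ C).HasEdge (G.tgt e₀) b := by
    rcases hb with rfl | rfl | hb
    exacts [tgtSrc, .refl, fromTgt b hb]
  exact (haSrc.tail bridge).trans hTgtb
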